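/- Assume M is ∞-spanned and the indexing of the generators is adapted as in the Labelling lemma. Then for every reachable state D of the shortlex automaton ShortLex with D ≠ ∅ (and D not the fail state), there exists a word u over the alphabet {1, …, n} such that all transitions along u starting from D are defined and δ̂(D, u) = {α_1}. -/

import Mathlib

open scoped BigOperators

/-- The simple root `α_i`, the `i`-th standard basis vector of `ℝ^n`. -/
noncomputable def simpleRoot {n : ℕ} (i : Fin n) : Fin n → ℝ := Pi.single i 1

/-- The symmetric bilinear form `B` associated to the Coxeter matrix `M`, determined by
`B(α_i, α_j) = -cos (π / M i j)` when `M i j ≠ 0` and `B(α_i, α_j) = -1` when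
`M i j = 0` (the label `∞`). -/
noncomputable def bform {n : ℕ} (M : CoxeterMatrix (Fin n)) (u v : Fin n → ℝ) : ℝ :=
  ∑ i, ∑ j, u i * (if M i j = 0 then -1 else -Real.cos (Real.pi / (M i j))) * v j

/-- The simple reflection `σ_i(v) = v - 2 B(v, α_i) α_i`. -/
noncomputable def simpleRefl {n : ℕ} (M : CoxeterMatrix (Fin n)) (i : Fin n)
    (v : Fin n → ℝ) : Fin n → ℝ :=
  v - (2 * bform M v (simpleRoot i)) • simpleRoot i

/-- The set `Σ` of small roots of `M`: the smallest set of vectors containing the simple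
roots `α_1, …, α_n` and such that whenever `v ∈ Σ` and `-1 < B(v, α_i) < 0`, also
`σ_i(v) ∈ Σ`. -/
inductive IsSmallRoot {n : ℕ} (M : CoxeterMatrix (Fin n)) : (Fin n → ℝ) → Prop
  | simple (i : Fin n) : IsSmallRoot M (simpleRoot i)
  | reflect {v : Fin n → ℝ} (i : Fin n) : IsSmallRoot M v →
      -1 < bform M v (simpleRoot i) → bform M v (simpleRoot i) < 0 →
      IsSmallRoot M (simpleRefl M i v)

/-- The transition function of the geodesic automaton `Geo` (defined when `α_i ∉ D`):
`δ(D, i) = {α_i} ∪ (σ_i(D) ∩ Σ)`. -/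
noncomputable def stepGeo {n : ℕ} (M : CoxeterMatrix (Fin n)) (D : Set (Fin n → ℝ))
    (i : Fin n) : Set (Fin n → ℝ) :=
  insert (simpleRoot i) (simpleRefl M i '' D ∩ {v | IsSmallRoot M v})

/-- The transition function of the shortlex automaton `ShortLex` (defined when `α_i ∉ D`):
`δ(D, i) = {α_i} ∪ ((σ_i(D) ∪ {σ_i(α_l) : l < i}) ∩ Σ)`. -/
noncomputable def stepSL {n : ℕ} (M : CoxeterMatrix (Fin n)) (D : Set (Fin n → ℝ))
    (i : Fin n) : Set (Fin n → ℝ) :=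
  insert (simpleRoot i)
    ((simpleRefl M i '' D ∪ simpleRefl M i '' {v | ∃ l : Fin n, l < i ∧ v = simpleRoot l})
      ∩ {v | IsSmallRoot M v})

/-- All transitions of the automaton with transition function `step` are defined (do not
fail) when reading the word `u` from the state `D`; a transition out of `D` along the letter
`i` is defined exactly when `α_i ∉ D`. -/
def DefinedFrom {n : ℕ} (step : Set (Fin n → ℝ) → Fin n → Set (Fin n → ℝ)) :
    Set (Fin n → ℝ) → List (Fin n) → Prop
  | _, [] => True
  | D, i :: u => simpleRoot i ∉ D ∧ DefinedFrom step (step D i) u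

/-- The enhanced transition function `δ̂(D, u)`: the state obtained by reading the word `u`
from the state `D`. -/
def run {n : ℕ} (step : Set (Fin n → ℝ) → Fin n → Set (Fin n → ℝ))
    (D : Set (Fin n → ℝ)) (u : List (Fin n)) : Set (Fin n → ℝ) :=
  u.foldl step D

/-- A state is reachable if it is obtained from the start state `∅` by reading some word all
of whose transitions are defined. -/
def Reachable {n : ℕ} (step : Set (Fin n → ℝ) → Fin n → Set (Fin n → ℝ))
    (D : Set (Fin n → ℝ)) : Prop :=
  ∃ u : List (Fin n), DefinedFrom step ∅ u ∧ run step ∅ u = D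

/-- The graph of `∞`-edges of the Coxeter matrix `M`: `i ≠ j` are adjacent iff `M i j = 0`. -/
def infGraph {n : ℕ} (M : CoxeterMatrix (Fin n)) : SimpleGraph (Fin n) :=
  SimpleGraph.fromRel (fun i j => M i j = 0)

/-- The indexing of the generators is adapted as in the Labelling lemma: there is a spanning
tree `Γ` of the graph of `∞`-edges containing the edges `{1,2}` and `{2,3}`, such that along
every simple path in `Γ` from the vertex `1` to a leaf of `Γ` the labels strictly increase.
(Vertices `1, 2, 3` correspond to the indices `0, 1, 2` of `Fin n`.) -/
def AdaptedLabelling {n : ℕ} (hn : 3 ≤ n) (M : CoxeterMatrix (Fin n)) : Prop :=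
  ∃ Γ : SimpleGraph (Fin n), Γ ≤ infGraph M ∧ Γ.Connected ∧ Γ.IsAcyclic ∧
    Γ.Adj ⟨0, by omega⟩ ⟨1, by omega⟩ ∧ Γ.Adj ⟨1, by omega⟩ ⟨2, by omega⟩ ∧
    ∀ (v : Fin n) (p : Γ.Walk ⟨0, by omega⟩ v), p.IsPath → (∃! w : Fin n, Γ.Adj v w) →
      p.support.Chain' (· < ·)

section Coordinates

variable {n : ℕ} {M : CoxeterMatrix (Fin n)}

lemma simpleRoot_self (i : Fin n) : simpleRoot i i = 1 := by
  simp [simpleRoot]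

lemma simpleRoot_of_ne {i j : Fin n} (h : j ≠ i) : simpleRoot i j = 0 := by
  simp [simpleRoot, h]

lemma bform_simpleRoot (M : CoxeterMatrix (Fin n)) (v : Fin n → ℝ) (i : Fin n) :
    bform M v (simpleRoot i) =
      ∑ k, v k * (if M k i = 0 then -1 else -Real.cos (Real.pi / (M k i))) := by
  unfold bform simpleRoot
  refine Finset.sum_congr rfl fun k _ => ?_
  rw [Finset.sum_eq_single i]
  · simp
  · intro j _ hj
    simp [hj]
  · simp

/-- Distinct simple roots have form value `0` or at most `-1/2`. -/
lemma coxeterEntry_eq_zero_or_le_neg_half {k i : Fin n} (h : k ≠ i) :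
    (if M k i = 0 then (-1 : ℝ) else -Real.cos (Real.pi / (M k i))) = 0 ∨
      (if M k i = 0 then (-1 : ℝ) else -Real.cos (Real.pi / (M k i))) ≤ -(1 / 2) := by
  have h1 : M k i ≠ 1 := M.off_diagonal k i h
  split_ifs with h0
  · right; norm_num
  · by_cases h2 : M k i = 2
    · left; simp [h2]
    · right
      have h3 : (3 : ℝ) ≤ (M k i : ℝ) := by
        have : 3 ≤ M k i := by omega
        exact_mod_cast this
      have hle : Real.pi / (M k i) ≤ Real.pi / 3 := by
        have := Real.pi_pos
        gcongr
      have := Real.cos_le_cos_of_nonneg_of_le_pi (by positivity)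
        (by linarith [Real.pi_pos]) hle
      rw [Real.cos_pi_div_three] at this
      linarith

lemma simpleRefl_of_ne {i j : Fin n} (h : j ≠ i) (v : Fin n → ℝ) :
    simpleRefl M i v j = v j := by
  simp [simpleRefl, simpleRoot_of_ne h]

lemma simpleRefl_self (i : Fin n) (v : Fin n → ℝ) :
    simpleRefl M i v i = v i - 2 * bform M v (simpleRoot i) := by
  simp [simpleRefl, simpleRoot_self]

/-- For a vector with nonnegative coordinates whose `i`-th coordinate vanishes, every term of
`B(v, α_i)` is nonpositive, so each one bounds the sum. -/
lemma bform_le_term {v : Fin n → ℝ} (hv : ∀ j, 0 ≤ v j) {i : Fin n} (hi : v i = 0)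
    (k : Fin n) :
    bform M v (simpleRoot i) ≤
      v k * (if M k i = 0 then -1 else -Real.cos (Real.pi / (M k i))) := by
  rw [bform_simpleRoot, ← Finset.add_sum_erase _ _ (Finset.mem_univ k)]
  refine add_le_of_nonpos_right (Finset.sum_nonpos fun j _ => ?_)
  by_cases hj : j = i
  · simp [hj, hi]
  · rcases coxeterEntry_eq_zero_or_le_neg_half (M := M) hj with h | h
    · simp [h]
    · exact mul_nonpos_of_nonneg_of_nonpos (hv j) (by linarith)

lemma bform_le_neg {v : Fin n → ℝ} (hv : ∀ j, 0 ≤ v j) {i k : Fin n} (hi : v i = 0)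
    (hk : M k i = 0) : bform M v (simpleRoot i) ≤ -v k := by
  simpa [hk] using bform_le_term (M := M) hv hi k

lemma ne_of_coxeter_eq_zero {i j : Fin n} (h : M i j = 0) : i ≠ j := by
  rintro rfl
  simp at h

/-- A small root has coordinates that vanish or are at least one, and its support contains no
`∞`-edge. -/
lemma IsSmallRoot.support {v : Fin n → ℝ} (hv : IsSmallRoot M v) :
    (∀ j, v j = 0 ∨ 1 ≤ v j) ∧ ∀ i j, M i j = 0 → v i = 0 ∨ v j = 0 := by
  induction hv with
  | simple i =>
    refine ⟨fun j => ?_, fun j k hjk => ?_⟩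
    · by_cases h : j = i
      · right; rw [h, simpleRoot_self]
      · left; exact simpleRoot_of_ne h
    · by_cases h : j = i
      · right; exact simpleRoot_of_ne fun hk => ne_of_coxeter_eq_zero hjk (h.trans hk.symm)
      · left; exact simpleRoot_of_ne h
  | @reflect v i hv hlow hneg ih =>
    obtain ⟨hcoord, hedge⟩ := ih
    have hnonneg : ∀ j, 0 ≤ v j := fun j => by rcases hcoord j with h | h <;> linarith
    have hnew : ∀ k, M k i = 0 → v k = 0 := by
      intro k hk
      rcases hedge k i hk with h | h
      · exact h
      · rcases hcoord k with h' | h'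
        · exact h'
        · linarith [bform_le_neg hnonneg h hk]
    refine ⟨fun j => ?_, fun j k hjk => ?_⟩
    · by_cases hj : j = i
      · subst hj
        right
        rw [simpleRefl_self]
        rcases hcoord j with h | h
        · obtain ⟨k, -, hk⟩ : ∃ k ∈ Finset.univ,
              v k * (if M k j = 0 then -1 else -Real.cos (Real.pi / (M k j))) < 0 := by
            by_contra! hcon
            have := Finset.sum_nonneg hcon
            rw [← bform_simpleRoot] at this
            linarith
          have hkj : k ≠ j := by
            rintro rfl
            simp [h] at hk
          have hterm := bform_le_term (M := M) hnonneg h k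
          rcases coxeterEntry_eq_zero_or_le_neg_half (M := M) hkj with hc | hc
          · simp [hc] at hk
          · rcases hcoord k with h' | h'
            · simp [h'] at hk
            · nlinarith
        · linarith
      · rw [simpleRefl_of_ne hj]
        exact hcoord j
    · by_cases hj : j = i
      · right
        subst hj
        rw [simpleRefl_of_ne (ne_of_coxeter_eq_zero hjk).symm]
        exact hnew k (by rw [M.symmetric]; exact hjk)
      · by_cases hk : k = i
        · left
          subst hk
          rw [simpleRefl_of_ne hj]
          exact hnew j hjk
        · rw [simpleRefl_of_ne hj, simpleRefl_of_ne hk]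
          exact hedge j k hjk

lemma IsSmallRoot.nonneg {v : Fin n → ℝ} (hv : IsSmallRoot M v) (j : Fin n) : 0 ≤ v j := by
  rcases hv.support.1 j with h | h <;> linarith

/-- The only small root supported on a single vertex is the simple root. -/
lemma IsSmallRoot.eq_simpleRoot {v : Fin n → ℝ} (hv : IsSmallRoot M v) {a : Fin n}
    (ha : ∀ j, j ≠ a → v j = 0) : v = simpleRoot a := by
  cases hv with
  | simple i =>
    by_cases h : i = a
    · rw [h]
    · have := ha i h
      rw [simpleRoot_self] at this
      norm_num at this
  | @reflect w i hw hlow hneg =>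
    exfalso
    have hia : i = a := by
      by_contra h
      have := ha i h
      rw [simpleRefl_self] at this
      linarith [hw.nonneg i]
    subst hia
    have hw0 : ∀ j, j ≠ i → w j = 0 := fun j hj => by
      rw [← ha j hj, simpleRefl_of_ne hj]
    rw [bform_simpleRoot, Finset.sum_eq_single i (fun j _ hj => by simp [hw0 j hj])
      (by simp)] at hneg
    have := hw.nonneg i
    simp at hneg
    linarith

end Coordinates

section States

variable {n : ℕ} {M : CoxeterMatrix (Fin n)}

/-- `D` looks like a state entered by reading the letter `i`: it consists of small roots,
contains `α_i`, and none of its roots has an `∞`-neighbour of `i` in its support. -/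
structure IsStateAt (M : CoxeterMatrix (Fin n)) (i : Fin n) (D : Set (Fin n → ℝ)) : Prop where
  small : ∀ v ∈ D, IsSmallRoot M v
  mem : simpleRoot i ∈ D
  eq_zero : ∀ v ∈ D, ∀ j, M i j = 0 → v j = 0

lemma isStateAt_stepSL {D : Set (Fin n → ℝ)} (hD : ∀ v ∈ D, IsSmallRoot M v) (i : Fin n) :
    IsStateAt M i (stepSL M D i) where
  small := by
    rintro v (rfl | ⟨-, hv⟩)
    · exact .simple i
    · exact hv
  mem := Set.mem_insert _ _
  eq_zero := by
    rintro v (rfl | ⟨hmem, hv⟩) j hij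
    · exact simpleRoot_of_ne (ne_of_coxeter_eq_zero hij).symm
    obtain ⟨w, hw, rfl⟩ : ∃ w, IsSmallRoot M w ∧ simpleRefl M i w = v := by
      rcases hmem with ⟨w, hw, rfl⟩ | ⟨w, ⟨l, -, rfl⟩, rfl⟩
      · exact ⟨w, hD w hw, rfl⟩
      · exact ⟨_, .simple l, rfl⟩
    have hv : IsSmallRoot M (simpleRefl M i w) := hv
    by_contra hne
    have hvi := (hv.support.2 i j hij).resolve_right hne
    rw [simpleRefl_of_ne (ne_of_coxeter_eq_zero hij).symm] at hne
    have hwi := (hw.support.2 i j hij).resolve_right hne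
    rw [simpleRefl_self, hwi] at hvi
    have hle := bform_le_neg hw.nonneg hwi (by rw [M.symmetric]; exact hij : M j i = 0)
    have hpos := (hw.nonneg j).lt_of_ne' hne
    linarith

lemma IsStateAt.notMem {i j : Fin n} {D : Set (Fin n → ℝ)} (h : IsStateAt M i D)
    (hij : M i j = 0) : simpleRoot j ∉ D := fun hj => by
  have := h.eq_zero _ hj j hij
  rw [simpleRoot_self] at this
  norm_num at this

/-- All roots of `D` are supported on the labels at most `k`. -/
def SupportedBelow (k : ℕ) (D : Set (Fin n → ℝ)) : Prop :=
  ∀ v ∈ D, ∀ j : Fin n, k < (j : ℕ) → v j = 0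

lemma SupportedBelow.stepSL {k : ℕ} {D : Set (Fin n → ℝ)} (h : SupportedBelow k D)
    {i : Fin n} (hi : (i : ℕ) ≤ k) : SupportedBelow k (stepSL M D i) := by
  rintro v (rfl | ⟨⟨w, hw, rfl⟩ | ⟨w, ⟨l, hl, rfl⟩, rfl⟩, -⟩) j hj
  · exact simpleRoot_of_ne (by rintro rfl; omega)
  · rw [simpleRefl_of_ne (by rintro rfl; omega)]
    exact h w hw j hj
  · rw [simpleRefl_of_ne (by rintro rfl; omega)]
    have : (l : ℕ) < i := hl
    exact simpleRoot_of_ne (by rintro rfl; omega)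

/-- Reading the vertices of a walk along `∞`-edges that stays within the labels at most `k`. -/
lemma exists_run_of_reflTransGen {k : ℕ} {i j : Fin n}
    (hij : Relation.ReflTransGen (fun a b : Fin n => M a b = 0 ∧ (b : ℕ) ≤ k) i j)
    {D : Set (Fin n → ℝ)} (hD : IsStateAt M i D) (hk : SupportedBelow k D) :
    ∃ u, DefinedFrom (stepSL M) D u ∧ IsStateAt M j (run (stepSL M) D u) ∧
      SupportedBelow k (run (stepSL M) D u) := by
  induction hij using Relation.ReflTransGen.head_induction_on generalizing D with
  | refl => exact ⟨[], trivial, hD, hk⟩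
  | head hab _ ih =>
    obtain ⟨u, hu, hstate, hsupp⟩ := ih (isStateAt_stepSL hD.small _) (hk.stepSL hab.2)
    exact ⟨_ :: u, ⟨hD.notMem hab.1, hu⟩, hstate, hsupp⟩

lemma DefinedFrom.append {step : Set (Fin n → ℝ) → Fin n → Set (Fin n → ℝ)} :
    ∀ {D : Set (Fin n → ℝ)} {u w : List (Fin n)}, DefinedFrom step D u →
      DefinedFrom step (run step D u) w → DefinedFrom step D (u ++ w)
  | _, [], _, _, hw => hw
  | _, _ :: _, _, hu, hw => ⟨hu.1, hu.2.append hw⟩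

/-- If every vertex other than `r` has an `∞`-neighbour with a smaller label, then any two
labels at most `k` are joined by a walk along `∞`-edges staying within the labels at most
`k`. -/
lemma reflTransGen_of_parent {r : Fin n} (hpar : ∀ v, v ≠ r → ∃ p, p < v ∧ M p v = 0)
    {k : ℕ} {i j : Fin n} (hi : (i : ℕ) ≤ k) (hj : (j : ℕ) ≤ k) :
    Relation.ReflTransGen (fun a b : Fin n => M a b = 0 ∧ (b : ℕ) ≤ k) i j := by
  suffices h : ∀ v : Fin n, (v : ℕ) ≤ k →
      Relation.ReflTransGen (fun a b : Fin n => M a b = 0 ∧ (b : ℕ) ≤ k) v r ∧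
      Relation.ReflTransGen (fun a b : Fin n => M a b = 0 ∧ (b : ℕ) ≤ k) r v from
    (h i hi).1.trans (h j hj).2
  intro v
  induction v using WellFoundedLT.induction with
  | ind v ih =>
    intro hv
    by_cases hvr : v = r
    · rw [hvr]
      exact ⟨.refl, .refl⟩
    · obtain ⟨p, hpv, hp⟩ := hpar v hvr
      have hpk : (p : ℕ) ≤ k := (Fin.lt_def.1 hpv).le.trans hv
      obtain ⟨hdown, hup⟩ := ih p hpv hpk
      exact ⟨hdown.head ⟨by rw [M.symmetric]; exact hp, hpk⟩, hup.tail ⟨hp, hv⟩⟩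

lemma exists_run_eq_singleton {r : Fin n} (hr : (r : ℕ) = 0)
    (hpar : ∀ v, v ≠ r → ∃ p, p < v ∧ M p v = 0) {k : ℕ} (hkn : k < n) :
    ∀ {i : Fin n} {D : Set (Fin n → ℝ)}, (i : ℕ) ≤ k → IsStateAt M i D → SupportedBelow k D →
      ∃ u, DefinedFrom (stepSL M) D u ∧ run (stepSL M) D u = {simpleRoot r} := by
  induction k with
  | zero =>
    intro i D hi hD hk
    obtain rfl : i = r := Fin.ext (by omega)
    refine ⟨[], trivial, Set.eq_singleton_iff_unique_mem.2 ⟨hD.mem, fun v hv => ?_⟩⟩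
    refine (hD.small v hv).eq_simpleRoot fun j hj => hk v hv j ?_
    have : (j : ℕ) ≠ i := fun h => hj (Fin.ext h)
    omega
  | succ k ih =>
    intro i D hi hD hk
    obtain ⟨p, hpt, hp⟩ := hpar ⟨k + 1, hkn⟩ (by rintro rfl; simp at hr)
    have hpk : (p : ℕ) ≤ k := Nat.lt_succ_iff.1 hpt
    obtain ⟨u, hu, hstate, hsupp⟩ :=
      exists_run_of_reflTransGen (reflTransGen_of_parent hpar hi (hpk.trans k.le_succ)) hD hk
    have hsupp' : SupportedBelow k (run (stepSL M) D u) := by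
      intro v hv j hj
      rcases (show k + 1 ≤ (j : ℕ) from hj).eq_or_lt with h | h
      · exact hstate.eq_zero v hv j ((Fin.ext h : (⟨k + 1, hkn⟩ : Fin n) = j) ▸ hp)
      · exact hsupp v hv j h
    obtain ⟨w, hw, hrun⟩ := ih (by omega) hpk hstate hsupp'
    refine ⟨u ++ w, hu.append hw, ?_⟩
    rw [← hrun]
    simp [run, List.foldl_append]

lemma Reachable.exists_isStateAt {D : Set (Fin n → ℝ)} (hD : Reachable (stepSL M) D)
    (hne : D ≠ ∅) : ∃ i, IsStateAt M i D := by
  obtain ⟨u, -, rfl⟩ := hD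
  have hsmall : ∀ u : List (Fin n), ∀ v ∈ run (stepSL M) ∅ u, IsSmallRoot M v := by
    intro u
    induction u using List.reverseRecOn with
    | nil => simp [run]
    | append_singleton u i ih =>
      simpa [run] using (isStateAt_stepSL ih i).small
  rcases List.eq_nil_or_concat u with rfl | ⟨u, i, rfl⟩
  · exact absurd rfl hne
  · exact ⟨i, by simpa [run] using isStateAt_stepSL (hsmall u) i⟩

end States

/-- In a finite acyclic graph whose paths from `r` to leaves are increasing, all paths from `r`
of positive length are increasing. -/
lemma isChain_support_of_isPath {V : Type*} [Fintype V] [LT V] {Γ : SimpleGraph V}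
    (hac : Γ.IsAcyclic) {r : V}
    (hleaf : ∀ (v : V) (p : Γ.Walk r v), p.IsPath → (∃! w : V, Γ.Adj v w) →
      p.support.IsChain (· < ·))
    {v : V} (p : Γ.Walk r v) (hp : p.IsPath) (hnil : ¬ p.Nil) :
    p.support.IsChain (· < ·) := by
  induction hm : Fintype.card V - p.length using Nat.strong_induction_on generalizing v with
  | _ m ih =>
    have hadj := (p.adj_penultimate hnil).symm
    by_cases huniq : ∃! w : V, Γ.Adj v w
    · exact hleaf v p hp huniq
    · obtain ⟨x, hx, hxp⟩ : ∃ x, Γ.Adj v x ∧ x ≠ p.penultimate := by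
        by_contra! hcon
        exact huniq ⟨_, hadj, hcon⟩
      have hxs : x ∉ p.support := fun h => hxp (hac.eq_penultimate_of_adj_end hp hx h)
      have hlt := hp.length_lt
      have hchain := ih _ (by rw [← hm, SimpleGraph.Walk.length_concat]; omega)
        (p.concat hx) (hp.concat hxs hx) (by simp [← SimpleGraph.Walk.length_eq_zero_iff]) rfl
      rw [SimpleGraph.Walk.support_concat, List.isChain_append] at hchain
      exact hchain.1

/-- In an adapted labelling every vertex other than the first has an `∞`-neighbour with a
smaller label. -/
lemma AdaptedLabelling.exists_lt {n : ℕ} {hn : 3 ≤ n} {M : CoxeterMatrix (Fin n)}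
    (h : AdaptedLabelling hn M) (v : Fin n) (hv : v ≠ ⟨0, by omega⟩) :
    ∃ p, p < v ∧ M p v = 0 := by
  obtain ⟨Γ, hle, hconn, hac, -, -, hleaf⟩ := h
  obtain ⟨p, hp⟩ := hconn.exists_isPath ⟨0, by omega⟩ v
  have hnil : ¬ p.Nil := fun h => hv h.eq.symm
  have hchain := isChain_support_of_isPath hac hleaf p hp hnil
  refine ⟨p.penultimate, ?_, ?_⟩
  · rw [← p.concat_dropLast (p.adj_penultimate hnil), SimpleGraph.Walk.support_concat,
      List.isChain_append] at hchain
    refine hchain.2.2 _ ?_ _ (by simp)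
    simp [List.getLast?_eq_some_getLast]
  · have := hle (p.adj_penultimate hnil)
    rw [infGraph, SimpleGraph.fromRel_adj] at this
    rcases this.2 with h | h
    · exact h
    · rw [M.symmetric]; exact h

/-- **Hydra's lemma** for the shortlex automaton: if `M` is `∞`-spanned and the indexing is
adapted as in the Labelling lemma, then from every reachable nonempty (non-fail) state `D`
one can reach the state `{α_1}` by reading some word all of whose transitions are defined. -/
theorem hydra_shortlex {n : ℕ} (hn : 3 ≤ n) (M : CoxeterMatrix (Fin n))
    (hspan : (infGraph M).Connected) (hadapt : AdaptedLabelling hn M) :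
    ∀ D : Set (Fin n → ℝ), Reachable (stepSL M) D → D ≠ ∅ →
      ∃ u : List (Fin n), DefinedFrom (stepSL M) D u ∧
        run (stepSL M) D u = {simpleRoot (⟨0, by omega⟩ : Fin n)} := by
  intro D hD hne
  obtain ⟨i, hi⟩ := hD.exists_isStateAt hne
  exact exists_run_eq_singleton rfl hadapt.exists_lt (k := n - 1) (by omega)
    (by have := i.isLt; omega) hi fun v _ j hj => absurd j.isLt (by omega)
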